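/- Let T be an irreducible positive trace-preserving linear map on M_n with unique invariant state π, and let V ⊆ ℂⁿ be a nontrivial subspace. Define the fixed map Ω(X) := Tr(X)·π, the fundamental map Z := (I − T + Ω)^{−1} (which exists), and the mean hitting time map K := T(I − ℚT)^{−2} (which exists since 1 is not an eigenvalue of ℚT). Write S₁₁ := (I−ℚ)∘S∘(I−ℚ) and S₁₂ := (I−ℚ)∘S∘ℚ for the blocks of a map S on M_n. Then for every unit vector ψ ∈ V and every unit vector φ ∈ V^⊥, the mean hitting time satisfies τ(φ→V) = Tr( K₁₁( Z₁₁(ρ_ψ) − Z₁₂(ρ_φ) ) ); in particular, the quantity Tr(K₁₁(Z₁₁(ρ_ψ))) does not depend on the choice of the unit vector ψ ∈ V. -/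

import Mathlib

open Matrix
open scoped ComplexOrder

noncomputable section

/-- The algebra of `n × n` complex matrices. -/
abbrev Mn (n : ℕ) : Type := Matrix (Fin n) (Fin n) ℂ

/-- The map `X ↦ Q X Q`. -/
def sandwich {n : ℕ} (Q : Mn n) : Module.End ℂ (Mn n) :=
  (LinearMap.mulLeft ℂ Q).comp (LinearMap.mulRight ℂ Q)

/-- The sum of the two components of a pair. -/
def sumPair (n : ℕ) : (Mn n × Mn n) →ₗ[ℂ] Mn n :=
  LinearMap.fst ℂ (Mn n) (Mn n) + LinearMap.snd ℂ (Mn n) (Mn n)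

/-- The QMC `Λ_{T,V}` induced by the channel `T` and the subspace `V` (with orthogonal
projection `P` onto `V` and `Q = I − P`):
`Λ(X₁,X₂) = ((I−ℚ)(T(X₁+X₂)), ℚ(T(X₁+X₂)))` where `ℚ(Y) = QYQ`. -/
def Lam {n : ℕ} (T : Module.End ℂ (Mn n)) (Q : Mn n) : Module.End ℂ (Mn n × Mn n) :=
  LinearMap.prod
    (((1 : Module.End ℂ (Mn n)) - sandwich Q) ∘ₗ (T ∘ₗ sumPair n))
    ((sandwich Q) ∘ₗ (T ∘ₗ sumPair n))

/-- `ℙ₁(X₁,X₂) = (X₁,0)`. -/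
def proj1 (n : ℕ) : Module.End ℂ (Mn n × Mn n) :=
  (LinearMap.inl ℂ (Mn n) (Mn n)).comp (LinearMap.fst ℂ (Mn n) (Mn n))

/-- `ℙ₂(X₁,X₂) = (0,X₂)`. -/
def proj2 (n : ℕ) : Module.End ℂ (Mn n × Mn n) :=
  (LinearMap.inr ℂ (Mn n) (Mn n)).comp (LinearMap.snd ℂ (Mn n) (Mn n))

/-- The block-diagonal part `S_d = diag(S₁₁,S₂₂)` of a map on `M_n ⊕ M_n`. -/
def diagPart {n : ℕ} (S : Module.End ℂ (Mn n × Mn n)) : Module.End ℂ (Mn n × Mn n) :=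
  proj1 n * S * proj1 n + proj2 n * S * proj2 n

/-- The map `E(X₁,X₂) = (X₁+X₂, X₁+X₂)`. -/
def Emap (n : ℕ) : Module.End ℂ (Mn n × Mn n) :=
  LinearMap.prod (sumPair n) (sumPair n)

/-- The map `Θ_W(X₁,X₂) = Tr(X₁+X₂)·W`. -/
def Theta {n : ℕ} (W : Mn n × Mn n) : Module.End ℂ (Mn n × Mn n) :=
  ((Matrix.traceLinearMap (Fin n) ℂ ℂ) ∘ₗ sumPair n).smulRight W

/-- The mean hitting time `τ(ρ → V) = Σ_{r ≥ 1} r·Tr(ℙT(ℚT)^{r−1} ρ)`. -/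
def tau {n : ℕ} (T : Module.End ℂ (Mn n)) (P Q : Mn n) (ρ : Mn n) : ℂ :=
  ∑' r : ℕ, ((r : ℂ) + 1) * ((sandwich P * T * (sandwich Q * T) ^ r) ρ).trace

/-- The pure state `ρ_φ = |φ⟩⟨φ|`. -/
def rhoOf {n : ℕ} (φ : Fin n → ℂ) : Mn n := Matrix.vecMulVec φ (star φ)

/-- A positive map on `M_n`. -/
def IsPosMap {n : ℕ} (T : Module.End ℂ (Mn n)) : Prop :=
  ∀ X : Mn n, X.PosSemidef → (T X).PosSemidef

/-- A trace-preserving map on `M_n`. -/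
def IsTracePreserving {n : ℕ} (T : Module.End ℂ (Mn n)) : Prop :=
  ∀ X : Mn n, (T X).trace = X.trace

/-- A quantum channel: a completely positive trace-preserving map, given by a Kraus
decomposition `T(X) = Σᵢ Vᵢ X Vᵢ*` with `Σᵢ Vᵢ* Vᵢ = I`. -/
def IsChannel {n : ℕ} (T : Module.End ℂ (Mn n)) : Prop :=
  ∃ (k : ℕ) (V : Fin k → Mn n),
    (∀ X : Mn n, T X = ∑ i, V i * X * (V i)ᴴ) ∧ (∑ i, (V i)ᴴ * V i = 1)

/-- Irreducibility of a positive map on `M_n`: the only orthogonal projections `P` with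
`T(P M_n P) ⊆ P M_n P` are `P = 0` and `P = I`. -/
def IsIrreducibleMap {n : ℕ} (T : Module.End ℂ (Mn n)) : Prop :=
  ∀ P : Mn n, P.IsHermitian → P * P = P →
    (∀ X : Mn n, ∃ Y : Mn n, T (P * X * P) = P * Y * P) → P = 0 ∨ P = 1

namespace PosMapHitting

section Preliminaries

variable {n : ℕ}

theorem posSemidef_rhoOf (x : Fin n → ℂ) : (rhoOf x).PosSemidef :=
  posSemidef_vecMulVec_self_star x

theorem exists_sum_rhoOf {X : Mn n} (hX : X.PosSemidef) :
    ∃ (m : ℕ) (v : Fin m → (Fin n → ℂ)), X = ∑ k, rhoOf (v k) :=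
  posSemidef_iff_eq_sum_vecMulVec.mp hX

theorem rhoOf_smul (c : ℂ) (x : Fin n → ℂ) : rhoOf (c • x) = (‖c‖ ^ 2 : ℝ) • rhoOf x := by
  ext i j
  simp only [rhoOf, vecMulVec_apply, Pi.smul_apply, Pi.star_apply, smul_eq_mul, star_mul',
    Matrix.smul_apply, Complex.real_smul]
  have h : c * star c = ((‖c‖ ^ 2 : ℝ) : ℂ) := by
    rw [Complex.star_def, Complex.mul_conj, Complex.normSq_eq_norm_sq]
  rw [← h]; ring

theorem rhoOf_zero : rhoOf (0 : Fin n → ℂ) = 0 := by simp [rhoOf]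

theorem rhoOf_add_add_rhoOf_sub (x y : Fin n → ℂ) :
    rhoOf (x + y) + rhoOf (x - y) = (2 : ℝ) • rhoOf x + (2 : ℝ) • rhoOf y := by
  ext i j
  simp [rhoOf, vecMulVec_apply]
  ring

theorem mul_rhoOf_mul (A : Mn n) (x : Fin n → ℂ) : A * rhoOf x * Aᴴ = rhoOf (A *ᵥ x) := by
  simp [rhoOf, mul_vecMulVec, vecMulVec_mul, star_mulVec]

theorem trace_rhoOf (x : EuclideanSpace ℂ (Fin n)) :
    (rhoOf x.ofLp).trace = ((‖x‖ ^ 2 : ℝ) : ℂ) := by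
  rw [rhoOf, trace_vecMulVec, EuclideanSpace.norm_sq_eq]
  simp [dotProduct, Complex.mul_conj, Complex.normSq_eq_norm_sq]

/-- The real part of the trace, as a real-linear functional. -/
def reTrace (n : ℕ) : Mn n →ₗ[ℝ] ℝ :=
  Complex.reLm ∘ₗ (Matrix.traceLinearMap (Fin n) ℝ ℂ)

theorem reTrace_apply (X : Mn n) : reTrace n X = X.trace.re := rfl

theorem reTrace_nonneg {X : Mn n} (hX : X.PosSemidef) : 0 ≤ reTrace n X :=
  (Complex.le_def.mp hX.trace_nonneg).1

theorem trace_eq_reTrace {X : Mn n} (hX : X.PosSemidef) : X.trace = ((reTrace n X : ℝ) : ℂ) :=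
  Complex.ext rfl (Complex.le_def.mp hX.trace_nonneg).2.symm

/-- A linear map on matrices is determined by its values on rank-one positive matrices. -/
theorem ext_rhoOf {M : Type*} [AddCommGroup M] [Module ℂ M] {F G : Mn n →ₗ[ℂ] M}
    (h : ∀ x, F (rhoOf x) = G (rhoOf x)) : F = G := by
  have key : ∀ x y : Fin n → ℂ, vecMulVec x (star y) =
      (1 / 4 : ℂ) • (rhoOf (x + y) - rhoOf (x - y)
        + Complex.I • rhoOf (x + Complex.I • y) - Complex.I • rhoOf (x - Complex.I • y)) := by
    intro x y
    ext i j
    simp [rhoOf, vecMulVec_apply]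
    ring_nf
    simp
    ring
  refine Matrix.ext_linearMap ℂ fun i j => ?_
  ext
  have hs : Matrix.single i j (1 : ℂ) = vecMulVec (Pi.single i 1) (star (Pi.single j 1)) := by
    rw [← Pi.single_star, star_one, Matrix.single_eq_single_vecMulVec_single]
  simp only [LinearMap.comp_apply, singleLinearMap_apply, hs, key, map_smul, map_sub, map_add, h]

theorem ext_posSemidef {M : Type*} [AddCommGroup M] [Module ℂ M] {F G : Mn n →ₗ[ℂ] M}
    (h : ∀ X : Mn n, X.PosSemidef → F X = G X) : F = G :=
  ext_rhoOf fun x => h _ (posSemidef_rhoOf x)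

theorem nonneg_of_rhoOf {g : Mn n →ₗ[ℝ] ℝ} (h : ∀ x, 0 ≤ g (rhoOf x)) {X : Mn n}
    (hX : X.PosSemidef) : 0 ≤ g X := by
  obtain ⟨m, v, rfl⟩ := exists_sum_rhoOf hX
  rw [map_sum]
  exact Finset.sum_nonneg fun k _ => h _

/-- A real-linear functional is bounded on positive matrices by a multiple of the trace, and the
optimal constant is attained at a rank-one matrix. -/
theorem exists_isMax_rhoOf (hn : 0 < n) (f : Mn n →ₗ[ℝ] ℝ) :
    ∃ (c : ℝ) (x : Fin n → ℂ), x ≠ 0 ∧ f (rhoOf x) = c * reTrace n (rhoOf x) ∧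
      ∀ X : Mn n, X.PosSemidef → f X ≤ c * reTrace n X := by
  have : Nonempty (Fin n) := ⟨⟨0, hn⟩⟩
  have hf : Continuous f := f.continuous_of_finiteDimensional
  have hρ : Continuous fun x : EuclideanSpace ℂ (Fin n) => rhoOf x.ofLp := by
    unfold rhoOf
    fun_prop
  obtain ⟨x, hx, hmax⟩ := (isCompact_sphere (0 : EuclideanSpace ℂ (Fin n)) 1).exists_isMaxOn
    (NormedSpace.sphere_nonempty.mpr zero_le_one) (hf.comp hρ).continuousOn
  have hx1 : ‖x‖ = 1 := by simpa using hx
  have hle : ∀ y : EuclideanSpace ℂ (Fin n),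
      f (rhoOf y.ofLp) ≤ f (rhoOf x.ofLp) * reTrace n (rhoOf y.ofLp) := by
    intro y
    rcases eq_or_ne y 0 with rfl | hy
    · simp [rhoOf_zero]
    have hy' : 0 < ‖y‖ := norm_pos_iff.mpr hy
    have hu := hmax (show ((‖y‖⁻¹ : ℝ) : ℂ) • y ∈ Metric.sphere _ 1 by
      simp [norm_smul, hy'.ne'])
    simp only [Set.mem_ofPred_eq, Function.comp_apply, WithLp.ofLp_smul, rhoOf_smul, map_smul,
      smul_eq_mul] at hu
    rw [reTrace_apply, trace_rhoOf, Complex.ofReal_re]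
    have hc : ‖((‖y‖⁻¹ : ℝ) : ℂ)‖ = ‖y‖⁻¹ := by simp
    rw [hc, inv_pow, inv_mul_le_iff₀ (by positivity)] at hu
    linarith
  refine ⟨f (rhoOf x.ofLp), x.ofLp, ?_, ?_, fun X hX => ?_⟩
  · intro h
    have : x = 0 := by ext i; simp [h]
    simp [this] at hx1
  · rw [reTrace_apply, trace_rhoOf, hx1]; simp
  · have := nonneg_of_rhoOf (g := f (rhoOf x.ofLp) • reTrace n - f)
      (fun y => by simpa using hle (WithLp.toLp 2 y)) hX
    simpa using this

theorem exists_norm_le_reTrace (hn : 0 < n) (g : Mn n →ₗ[ℂ] ℂ) :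
    ∃ C : ℝ, ∀ X : Mn n, X.PosSemidef → ‖g X‖ ≤ C * reTrace n X := by
  obtain ⟨a, -, -, -, ha⟩ := exists_isMax_rhoOf hn (Complex.reLm ∘ₗ g.restrictScalars ℝ)
  obtain ⟨b, -, -, -, hb⟩ := exists_isMax_rhoOf hn (-(Complex.reLm ∘ₗ g.restrictScalars ℝ))
  obtain ⟨c, -, -, -, hc⟩ := exists_isMax_rhoOf hn (Complex.imLm ∘ₗ g.restrictScalars ℝ)
  obtain ⟨d, -, -, -, hd⟩ := exists_isMax_rhoOf hn (-(Complex.imLm ∘ₗ g.restrictScalars ℝ))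
  refine ⟨|a| + |b| + (|c| + |d|), fun X hX => (Complex.norm_le_abs_re_add_abs_im _).trans ?_⟩
  have h0 := reTrace_nonneg hX
  have ha' := ha X hX
  have hb' := hb X hX
  have hc' := hc X hX
  have hd' := hd X hX
  simp only [LinearMap.neg_apply, LinearMap.comp_apply, LinearMap.restrictScalars_apply,
    Complex.reLm_coe, Complex.imLm_coe] at ha' hb' hc' hd'
  have e : ∀ t : ℝ, t * reTrace n X ≤ |t| * reTrace n X := fun t =>
    mul_le_mul_of_nonneg_right (le_abs_self t) h0
  have e' : ∀ t : ℝ, 0 ≤ |t| * reTrace n X := fun t => mul_nonneg (abs_nonneg t) h0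
  have h1 : |(g X).re| ≤ |a| * reTrace n X + |b| * reTrace n X :=
    abs_le.mpr ⟨by linarith [e b, e' a], by linarith [e a, e' b]⟩
  have h2 : |(g X).im| ≤ |c| * reTrace n X + |d| * reTrace n X :=
    abs_le.mpr ⟨by linarith [e d, e' c], by linarith [e c, e' d]⟩
  linarith

theorem tendsto_natCast_mul_of_antitone {s : ℕ → ℝ} {S : ℝ} (hs : Antitone s)
    (hs0 : Filter.Tendsto s Filter.atTop (nhds 0))
    (hS : Filter.Tendsto (fun N => ∑ k ∈ Finset.range N, s k) Filter.atTop (nhds S)) :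
    Filter.Tendsto (fun N : ℕ => (N : ℝ) * s N) Filter.atTop (nhds 0) := by
  have hnn : ∀ k, 0 ≤ s k := fun k => hs.le_of_tendsto hs0 k
  have hSle : ∀ N, ∑ k ∈ Finset.range N, s k ≤ S := fun N =>
    Monotone.ge_of_tendsto (f := fun N => ∑ k ∈ Finset.range N, s k)
      (monotone_nat_of_le_succ fun k => by
        rw [Finset.sum_range_succ]; linarith [hnn k]) hS N
  rw [Metric.tendsto_atTop]
  intro ε hε
  obtain ⟨M, hM⟩ := ((hS.eventually (lt_mem_nhds (show S - ε / 2 < S by linarith)))).exists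
  have h0 : Filter.Tendsto (fun N => (M : ℝ) * s N) Filter.atTop (nhds 0) := by
    simpa using hs0.const_mul (M : ℝ)
  obtain ⟨N₀, hN₀⟩ := Filter.eventually_atTop.mp (h0.eventually (gt_mem_nhds (half_pos hε)))
  refine ⟨max M N₀, fun N hN => ?_⟩
  have hMN : M ≤ N := (le_max_left _ _).trans hN
  have h1 := hN₀ N ((le_max_right _ _).trans hN)
  have h2 : ((N : ℝ) - M) * s N ≤ ∑ k ∈ Finset.Ico M N, s k := by
    have := Finset.card_nsmul_le_sum (Finset.Ico M N) s (s N)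
      (fun k hk => hs (Finset.mem_Ico.mp hk).2.le)
    rwa [Nat.card_Ico, nsmul_eq_mul, Nat.cast_sub hMN] at this
  rw [Finset.sum_Ico_eq_sub _ hMN] at h2
  rw [Real.dist_eq, sub_zero, abs_of_nonneg (mul_nonneg N.cast_nonneg (hnn N))]
  linarith [hSle N]

end Preliminaries

section Irreducible

variable {n : ℕ} {T : Module.End ℂ (Mn n)}

theorem sandwich_apply (Q X : Mn n) : sandwich Q X = Q * X * Q := by
  simp [sandwich, mul_assoc]

theorem isIrreducibleMap_eq_zero_or_one (hirr : IsIrreducibleMap T) {R : Mn n}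
    (hR : R.IsHermitian) (hR2 : R * R = R)
    (h : ∀ x, R * T (rhoOf (R *ᵥ x)) * R = T (rhoOf (R *ᵥ x))) : R = 0 ∨ R = 1 := by
  have h' : sandwich R * T * sandwich R = T * sandwich R := by
    refine ext_rhoOf fun x => ?_
    have hx : R * rhoOf x * R = rhoOf (R *ᵥ x) := by
      rw [← mul_rhoOf_mul R x, hR.eq]
    simp only [Module.End.mul_apply, sandwich_apply, hx, h]
  refine hirr R hR hR2 fun X => ⟨T (R * X * R), ?_⟩
  have := LinearMap.congr_fun h' X
  simpa [Module.End.mul_apply, sandwich_apply] using this.symm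

/-- The joint kernel of a family of positive functionals, as a subspace. -/
def nullSpace {ι : Type*} (g : ι → Mn n →ₗ[ℝ] ℝ) (hg : ∀ i x, 0 ≤ g i (rhoOf x)) :
    Submodule ℂ (EuclideanSpace ℂ (Fin n)) where
  carrier := {x | ∀ i, g i (rhoOf x.ofLp) = 0}
  zero_mem' := fun i => by simp [rhoOf_zero]
  add_mem' := fun {x y} hx hy i => by
    have h := congrArg (g i) (rhoOf_add_add_rhoOf_sub x.ofLp y.ofLp)
    simp only [map_add, map_smul, hx i, hy i, smul_zero, add_zero] at h
    have h1 := hg i (x.ofLp + y.ofLp)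
    have h2 := hg i (x.ofLp - y.ofLp)
    rw [WithLp.ofLp_add]
    linarith
  smul_mem' := fun c x hx i => by
    rw [WithLp.ofLp_smul, rhoOf_smul, map_smul, hx i, smul_zero]

theorem mem_nullSpace {ι : Type*} {g : ι → Mn n →ₗ[ℝ] ℝ} {hg : ∀ i x, 0 ≤ g i (rhoOf x)}
    {x : EuclideanSpace ℂ (Fin n)} :
    x ∈ nullSpace g hg ↔ ∀ i, g i (rhoOf x.ofLp) = 0 := Iff.rfl

/-- If the joint kernel of a family of positive functionals is preserved by an irreducible
positive map, then it is trivial. -/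
theorem nullSpace_trivial_of_irreducible (hTpos : IsPosMap T) (hirr : IsIrreducibleMap T)
    {ι : Type*} (g : ι → Mn n →ₗ[ℝ] ℝ) (hg : ∀ i x, 0 ≤ g i (rhoOf x))
    (hT : ∀ x, (∀ i, g i (rhoOf x) = 0) → ∀ i, g i (T (rhoOf x)) = 0) :
    (∀ x, (∀ i, g i (rhoOf x) = 0) → x = 0) ∨ ∀ i x, g i (rhoOf x) = 0 := by
  set W := nullSpace g hg
  let e := toEuclideanCLM (n := Fin n) (𝕜 := ℂ)
  obtain ⟨R, hRe⟩ : ∃ R : Mn n, e R = W.starProjection :=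
    ⟨e.symm W.starProjection, e.apply_symm_apply _⟩
  have hmul : ∀ x : Fin n → ℂ, R *ᵥ x = (W.starProjection (WithLp.toLp 2 x)).ofLp := by
    intro x
    rw [← hRe]; rfl
  have hRmem : ∀ x : Fin n → ℂ, ∀ i, g i (rhoOf (R *ᵥ x)) = 0 := fun x => by
    rw [hmul]
    exact mem_nullSpace.mp (W.starProjection_apply_mem _)
  have hRfix : ∀ x : Fin n → ℂ, (∀ i, g i (rhoOf x) = 0) → R *ᵥ x = x := fun x hx => by
    rw [hmul, W.starProjection_eq_self_iff.mpr (show WithLp.toLp 2 x ∈ W from hx)]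
  have hR : R.IsHermitian := by
    apply EquivLike.injective e
    rw [← star_eq_conjTranspose, map_star, hRe]
    exact isSelfAdjoint_starProjection W
  have hR2 : R * R = R := by
    apply EquivLike.injective e
    rw [map_mul, hRe]
    exact W.isIdempotentElem_starProjection
  have hcomp : ∀ X : Mn n, X.PosSemidef → (∀ i, g i X = 0) → R * X * R = X := by
    intro X hX hX0
    obtain ⟨m, v, rfl⟩ := exists_sum_rhoOf hX
    rw [Finset.mul_sum, Finset.sum_mul]
    refine Finset.sum_congr rfl fun k _ => ?_
    have hk : ∀ i, g i (rhoOf (v k)) = 0 := fun i => by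
      have := hX0 i
      rw [map_sum, Finset.sum_eq_zero_iff_of_nonneg fun k _ => hg i (v k)] at this
      exact this k (Finset.mem_univ k)
    have := mul_rhoOf_mul R (v k)
    rwa [hR.eq, hRfix _ hk] at this
  rcases isIrreducibleMap_eq_zero_or_one hirr hR hR2 (fun x =>
    hcomp _ (hTpos _ (posSemidef_rhoOf _)) (hT _ (hRmem x))) with h0 | h1
  · left
    intro x hx
    rw [← hRfix x hx, h0, zero_mulVec]
  · right
    intro i x
    simpa [h1] using hRmem x i

theorem eq_smul_reTrace_of_invariant (hTpos : IsPosMap T) (hTtr : IsTracePreserving T)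
    (hirr : IsIrreducibleMap T) (hn : 0 < n) (g : Mn n →ₗ[ℝ] ℝ) (hg : ∀ X, g (T X) = g X) :
    ∃ c : ℝ, ∀ x, g (rhoOf x) = c * reTrace n (rhoOf x) := by
  obtain ⟨c, x, hx, hgx, hc⟩ := exists_isMax_rhoOf hn g
  refine ⟨c, fun y => ?_⟩
  rcases nullSpace_trivial_of_irreducible hTpos hirr (fun _ : Unit => c • reTrace n - g)
    (fun _ x => by simpa using hc _ (posSemidef_rhoOf x))
    (fun x h i => by simpa [hg, reTrace_apply, hTtr (rhoOf x)] using h i) with h | h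
  · exact absurd (h x fun _ => by simp [hgx]) hx
  · have := h () y
    simp only [LinearMap.sub_apply, LinearMap.smul_apply, smul_eq_mul] at this
    linarith

/-- Invariant functionals of an irreducible positive trace-preserving map are multiples of the
trace. -/
theorem eq_smul_trace_of_invariant (hTpos : IsPosMap T) (hTtr : IsTracePreserving T)
    (hirr : IsIrreducibleMap T) (hn : 0 < n) (g : Mn n →ₗ[ℂ] ℂ) (hg : ∀ X, g (T X) = g X) :
    ∃ c : ℂ, ∀ X, g X = c * X.trace := by
  obtain ⟨a, ha⟩ := eq_smul_reTrace_of_invariant hTpos hTtr hirr hn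
    (Complex.reLm ∘ₗ g.restrictScalars ℝ) (fun X => by simp [hg])
  obtain ⟨b, hb⟩ := eq_smul_reTrace_of_invariant hTpos hTtr hirr hn
    (Complex.imLm ∘ₗ g.restrictScalars ℝ) (fun X => by simp [hg])
  refine ⟨⟨a, b⟩, fun X => ?_⟩
  have : g = (⟨a, b⟩ : ℂ) • traceLinearMap (Fin n) ℂ ℂ := by
    refine ext_rhoOf fun x => ?_
    have ha' := ha x
    have hb' := hb x
    simp only [LinearMap.comp_apply, LinearMap.restrictScalars_apply, Complex.reLm_coe,
      Complex.imLm_coe] at ha' hb'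
    rw [LinearMap.smul_apply, traceLinearMap_apply, smul_eq_mul,
      trace_eq_reTrace (posSemidef_rhoOf x)]
    apply Complex.ext <;> simp [ha', hb']
  rw [this]; simp

theorem isUnit_of_annihilator_eq_zero {S : Module.End ℂ (Mn n)}
    (h : ∀ g : Mn n →ₗ[ℂ] ℂ, (∀ X, g (S X) = 0) → g = 0) : IsUnit S := by
  rw [LinearMap.isUnit_iff_range_eq_top]
  by_contra hne
  obtain ⟨g, hg0, hg⟩ := Submodule.exists_le_ker_of_lt_top _ (lt_top_iff_ne_top.mpr hne)
  exact hg0 (h g fun X => hg (LinearMap.mem_range_self S X))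

theorem isUnit_one_sub_add (hTpos : IsPosMap T) (hTtr : IsTracePreserving T)
    (hirr : IsIrreducibleMap T) (hn : 0 < n) {π : Mn n} (hπtr : π.trace = 1) (hπfix : T π = π) :
    IsUnit (1 - T + (traceLinearMap (Fin n) ℂ ℂ).smulRight π) := by
  refine isUnit_of_annihilator_eq_zero fun g hg => ?_
  simp only [LinearMap.add_apply, LinearMap.sub_apply, Module.End.one_apply,
    LinearMap.smulRight_apply, traceLinearMap_apply, map_add, map_sub, map_smul,
    smul_eq_mul] at hg
  have hπ0 : g π = 0 := by simpa [hπfix, hπtr] using hg π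
  obtain ⟨c, hc⟩ := eq_smul_trace_of_invariant hTpos hTtr hirr hn g (fun X => by
    have := hg X
    rw [hπ0] at this
    linear_combination -this)
  have hc0 : c = 0 := by simpa [hπ0, hπtr] using (hc π).symm
  ext1 X
  simp [hc, hc0]

end Irreducible

section Hitting

variable {n : ℕ} {T : Module.End ℂ (Mn n)} {Q : Mn n}

theorem isPosMap_sandwich (hQ : Q.IsHermitian) : IsPosMap (sandwich Q) := fun X hX => by
  rw [sandwich_apply]
  nth_rewrite 2 [← hQ.eq]
  exact hX.mul_mul_conjTranspose_same Q

theorem trace_one_sub_sandwich (hQ2 : Q * Q = Q) (X : Mn n) :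
    (sandwich (1 - Q) X).trace = X.trace - (sandwich Q X).trace := by
  have h2 : (1 - Q) * (1 - Q) = 1 - Q := by
    simp [mul_sub, sub_mul, hQ2]
  rw [sandwich_apply, sandwich_apply, trace_mul_comm, ← mul_assoc, h2, trace_mul_comm (Q * X),
    ← mul_assoc, hQ2, sub_mul, one_mul, trace_sub]

theorem reTrace_sandwich_le (hQ : Q.IsHermitian) (hQ2 : Q * Q = Q) {X : Mn n}
    (hX : X.PosSemidef) : reTrace n (sandwich Q X) ≤ reTrace n X := by
  have h := reTrace_nonneg (isPosMap_sandwich (Matrix.isHermitian_one.sub hQ) X hX)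
  rw [reTrace_apply, trace_one_sub_sandwich hQ2, Complex.sub_re] at h
  simpa [reTrace_apply] using h

theorem sandwich_eq_self_of_reTrace_eq (hQ : Q.IsHermitian) (hQ2 : Q * Q = Q) {X : Mn n}
    (hX : X.PosSemidef) (h : reTrace n (sandwich Q X) = reTrace n X) : sandwich Q X = X := by
  have hP : (1 - Q).IsHermitian := Matrix.isHermitian_one.sub hQ
  have h0 : reTrace n (sandwich (1 - Q) X) = 0 := by
    rw [reTrace_apply, trace_one_sub_sandwich hQ2, Complex.sub_re, ← reTrace_apply,
      ← reTrace_apply, h, sub_self]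
  obtain ⟨m, v, rfl⟩ := exists_sum_rhoOf hX
  have hsw : ∀ {A : Mn n}, A.IsHermitian → ∀ x, sandwich A (rhoOf x) = rhoOf (A *ᵥ x) := by
    intro A hA x
    rw [sandwich_apply, ← mul_rhoOf_mul, hA.eq]
  rw [map_sum]
  refine Finset.sum_congr rfl fun k _ => ?_
  simp only [map_sum, hsw hP] at h0
  rw [Finset.sum_eq_zero_iff_of_nonneg fun k _ => reTrace_nonneg (posSemidef_rhoOf _)] at h0
  have hk := h0 k (Finset.mem_univ k)
  have hk' : reTrace n (rhoOf (WithLp.toLp 2 ((1 - Q) *ᵥ v k)).ofLp) = 0 := hk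
  rw [reTrace_apply, trace_rhoOf, Complex.ofReal_re, sq_eq_zero_iff, norm_eq_zero,
    WithLp.toLp_eq_zero, sub_mulVec, one_mulVec, sub_eq_zero] at hk'
  rw [hsw hQ, ← hk']

theorem isPosMap_pow {S : Module.End ℂ (Mn n)} (hS : IsPosMap S) (r : ℕ) : IsPosMap (S ^ r) := by
  induction r with
  | zero => exact fun X hX => hX
  | succ r ih =>
    intro X hX
    rw [pow_succ, Module.End.mul_apply]
    exact ih _ (hS X hX)

theorem isPosMap_killed (hTpos : IsPosMap T) (hQ : Q.IsHermitian) :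
    IsPosMap (sandwich Q * T) := fun X hX => isPosMap_sandwich hQ _ (hTpos X hX)

theorem antitone_reTrace_killed_pow (hTpos : IsPosMap T) (hTtr : IsTracePreserving T)
    (hQ : Q.IsHermitian) (hQ2 : Q * Q = Q) {X : Mn n} (hX : X.PosSemidef) :
    Antitone fun r => reTrace n (((sandwich Q * T) ^ r) X) := by
  refine antitone_nat_of_succ_le fun r => ?_
  have hY := isPosMap_pow (isPosMap_killed hTpos hQ) r X hX
  rw [pow_succ', Module.End.mul_apply, Module.End.mul_apply]
  refine (reTrace_sandwich_le hQ hQ2 (hTpos _ hY)).trans_eq ?_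
  rw [reTrace_apply, reTrace_apply, hTtr]

theorem exists_reTrace_killed_pow_lt (hTpos : IsPosMap T) (hTtr : IsTracePreserving T)
    (hirr : IsIrreducibleMap T) (hQ : Q.IsHermitian) (hQ2 : Q * Q = Q) (hQ0 : Q ≠ 0)
    (hQ1 : Q ≠ 1) {x : Fin n → ℂ} (hx : x ≠ 0) :
    ∃ r, reTrace n (((sandwich Q * T) ^ r) (rhoOf x)) < reTrace n (rhoOf x) := by
  set L := sandwich Q * T with hL
  have hle : ∀ r y, reTrace n ((L ^ r) (rhoOf y)) ≤ reTrace n (rhoOf y) := fun r y => by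
    simpa using antitone_reTrace_killed_pow hTpos hTtr hQ hQ2 (posSemidef_rhoOf y) r.zero_le
  let g : ℕ → Mn n →ₗ[ℝ] ℝ := fun r => reTrace n - reTrace n ∘ₗ (L ^ r).restrictScalars ℝ
  have hgapp : ∀ r X, g r X = reTrace n X - reTrace n ((L ^ r) X) := fun r X => rfl
  have hfix : ∀ y, (∀ r, g r (rhoOf y) = 0) → L (rhoOf y) = T (rhoOf y) := fun y hy => by
    refine sandwich_eq_self_of_reTrace_eq hQ hQ2 (hTpos _ (posSemidef_rhoOf y)) ?_
    have := hy 1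
    rw [hgapp, pow_one, hL, Module.End.mul_apply] at this
    rw [reTrace_apply (T _), hTtr, ← reTrace_apply]
    linarith
  rcases nullSpace_trivial_of_irreducible hTpos hirr g
    (fun r y => by rw [hgapp]; linarith [hle r y])
    (fun y hy r => by
      have h1 := hy 1
      have h2 := hy (r + 1)
      rw [hgapp, pow_one] at h1
      rw [hgapp, pow_succ, Module.End.mul_apply] at h2
      rw [hgapp, ← hfix y hy]
      linarith) with h | h
  · by_contra! hcon
    exact hx (h x fun r => by rw [hgapp]; linarith [hcon r, hle r x])
  · exfalso
    rcases isIrreducibleMap_eq_zero_or_one hirr hQ hQ2 (fun y => by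
      have := hfix _ (fun r => h r (Q *ᵥ y))
      rwa [hL, Module.End.mul_apply, sandwich_apply] at this) with h0 | h0
    · exact hQ0 h0
    · exact hQ1 h0

theorem exists_killed_pow_contraction (hTpos : IsPosMap T) (hTtr : IsTracePreserving T)
    (hirr : IsIrreducibleMap T) (hQ : Q.IsHermitian) (hQ2 : Q * Q = Q) (hQ0 : Q ≠ 0)
    (hQ1 : Q ≠ 1) (hn : 0 < n) :
    ∃ (N : ℕ) (c : ℝ), 0 ≤ c ∧ c < 1 ∧ ∀ X : Mn n, X.PosSemidef →
      reTrace n (((sandwich Q * T) ^ N) X) ≤ c * reTrace n X := by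
  set L := sandwich Q * T with hL
  let f : ℕ → Mn n →ₗ[ℝ] ℝ := fun r => reTrace n ∘ₗ (L ^ r).restrictScalars ℝ
  have hρ : Continuous fun x : EuclideanSpace ℂ (Fin n) => rhoOf x.ofLp := by
    unfold rhoOf
    fun_prop
  have hcont : ∀ r, Continuous fun x : EuclideanSpace ℂ (Fin n) => f r (rhoOf x.ofLp) :=
    fun r => (f r).continuous_of_finiteDimensional.comp hρ
  have hanti : ∀ y, Antitone fun r => f r (rhoOf y) := fun y =>
    antitone_reTrace_killed_pow hTpos hTtr hQ hQ2 (posSemidef_rhoOf y)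
  have hsub : Metric.sphere (0 : EuclideanSpace ℂ (Fin n)) 1 ⊆
      ⋃ r, {x : EuclideanSpace ℂ (Fin n) | f r (rhoOf x.ofLp) < 1} := by
    intro x hx
    have hx1 : ‖x‖ = 1 := by simpa using hx
    obtain ⟨r, hr⟩ := exists_reTrace_killed_pow_lt hTpos hTtr hirr hQ hQ2 hQ0 hQ1
      (x := x.ofLp) (by
        intro h
        have : x = 0 := by ext i; simp [h]
        simp [this] at hx1)
    refine Set.mem_iUnion.mpr ⟨r, ?_⟩
    rw [reTrace_apply (rhoOf _), trace_rhoOf, hx1] at hr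
    simpa [f] using hr
  obtain ⟨N, hN⟩ := (isCompact_sphere (0 : EuclideanSpace ℂ (Fin n)) 1).elim_directed_cover
    _ (fun r => isOpen_lt (hcont r) continuous_const) hsub
    (Monotone.directed_le fun r s hrs x hx => (hanti x.ofLp hrs).trans_lt hx)
  obtain ⟨c, x, hx, hfx, hc⟩ := exists_isMax_rhoOf hn (f N)
  have hx' : 0 < ‖WithLp.toLp 2 x‖ := norm_pos_iff.mpr (by simpa using hx)
  set y : EuclideanSpace ℂ (Fin n) := WithLp.toLp 2 x with hy
  have htr : reTrace n (rhoOf x) = ‖y‖ ^ 2 := by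
    rw [reTrace_apply, show x = y.ofLp from rfl, trace_rhoOf, Complex.ofReal_re]
  refine ⟨N, c, ?_, ?_, hc⟩
  · have h0 : 0 ≤ f N (rhoOf x) :=
      reTrace_nonneg (isPosMap_pow (isPosMap_killed hTpos hQ) N _ (posSemidef_rhoOf x))
    rw [hfx, htr] at h0
    exact nonneg_of_mul_nonneg_left h0 (by positivity)
  · have hu := hN (show ((‖y‖⁻¹ : ℝ) : ℂ) • y ∈ Metric.sphere _ 1 by
      simp [norm_smul, hx'.ne'])
    have hcn : ‖((‖y‖⁻¹ : ℝ) : ℂ)‖ = ‖y‖⁻¹ := by simp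
    simp only [Set.mem_ofPred_eq, WithLp.ofLp_smul, rhoOf_smul, map_smul, smul_eq_mul, hcn] at hu
    rw [show y.ofLp = x from rfl, hfx, htr, inv_pow, mul_comm c,
      inv_mul_cancel_left₀ (by positivity)] at hu
    exact hu

theorem tendsto_reTrace_killed_pow (hTpos : IsPosMap T) (hTtr : IsTracePreserving T)
    (hirr : IsIrreducibleMap T) (hQ : Q.IsHermitian) (hQ2 : Q * Q = Q) (hQ0 : Q ≠ 0)
    (hQ1 : Q ≠ 1) (hn : 0 < n) {X : Mn n} (hX : X.PosSemidef) :
    Filter.Tendsto (fun r => reTrace n (((sandwich Q * T) ^ r) X)) Filter.atTop (nhds 0) := by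
  obtain ⟨N, c, hc0, hc1, hc⟩ :=
    exists_killed_pow_contraction hTpos hTtr hirr hQ hQ2 hQ0 hQ1 hn
  set L := sandwich Q * T with hL
  have hpos : ∀ r, (((L ^ r) X)).PosSemidef := fun r =>
    isPosMap_pow (isPosMap_killed hTpos hQ) r X hX
  have hgeo : ∀ k, reTrace n ((L ^ (N * k)) X) ≤ c ^ k * reTrace n X := by
    intro k
    induction k with
    | zero => simp
    | succ k ih =>
      rw [Nat.mul_succ, add_comm, pow_add, Module.End.mul_apply, pow_succ', mul_assoc]
      exact (hc _ (hpos _)).trans (mul_le_mul_of_nonneg_left ih hc0)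
  have hlim : Filter.Tendsto (fun k => c ^ k * reTrace n X) Filter.atTop (nhds 0) := by
    simpa using (tendsto_pow_atTop_nhds_zero_of_lt_one hc0 hc1).mul_const (reTrace n X)
  rw [Metric.tendsto_atTop]
  intro ε hε
  obtain ⟨k, hk⟩ := (hlim.eventually (gt_mem_nhds hε)).exists
  refine ⟨N * k, fun r hr => ?_⟩
  rw [Real.dist_eq, sub_zero, abs_of_nonneg (reTrace_nonneg (hpos r))]
  exact ((antitone_reTrace_killed_pow hTpos hTtr hQ hQ2 hX hr).trans (hgeo k)).trans_lt hk

theorem tendsto_apply_killed_pow (hTpos : IsPosMap T) (hTtr : IsTracePreserving T)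
    (hirr : IsIrreducibleMap T) (hQ : Q.IsHermitian) (hQ2 : Q * Q = Q) (hQ0 : Q ≠ 0)
    (hQ1 : Q ≠ 1) (hn : 0 < n) {X : Mn n} (hX : X.PosSemidef) (g : Mn n →ₗ[ℂ] ℂ) :
    Filter.Tendsto (fun r => g (((sandwich Q * T) ^ r) X)) Filter.atTop (nhds 0) := by
  obtain ⟨C, hC⟩ := exists_norm_le_reTrace hn g
  refine squeeze_zero_norm (fun r => hC _ (isPosMap_pow (isPosMap_killed hTpos hQ) r X hX)) ?_
  simpa using (tendsto_reTrace_killed_pow hTpos hTtr hirr hQ hQ2 hQ0 hQ1 hn hX).const_mul C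

theorem isUnit_one_sub_killed (hTpos : IsPosMap T) (hTtr : IsTracePreserving T)
    (hirr : IsIrreducibleMap T) (hQ : Q.IsHermitian) (hQ2 : Q * Q = Q) (hQ0 : Q ≠ 0)
    (hQ1 : Q ≠ 1) (hn : 0 < n) : IsUnit (1 - sandwich Q * T) := by
  refine isUnit_of_annihilator_eq_zero fun g hg => ext_posSemidef fun X hX => ?_
  have hpow : ∀ r, g (((sandwich Q * T) ^ r) X) = g X := by
    intro r
    induction r with
    | zero => rfl
    | succ r ih =>
      rw [pow_succ', Module.End.mul_apply, ← ih]
      have := hg (((sandwich Q * T) ^ r) X)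
      rw [LinearMap.sub_apply, Module.End.one_apply, map_sub, sub_eq_zero] at this
      exact this.symm
  have h := tendsto_apply_killed_pow hTpos hTtr hirr hQ hQ2 hQ0 hQ1 hn hX g
  simp only [hpow] at h
  exact tendsto_nhds_unique tendsto_const_nhds h

/-- The mean hitting time is the trace of the resolvent `(1 - ℚT)⁻¹` applied to the initial
state. -/
theorem tau_eq_trace_inverse (hTpos : IsPosMap T) (hTtr : IsTracePreserving T)
    (hirr : IsIrreducibleMap T) (hQ : Q.IsHermitian) (hQ2 : Q * Q = Q) (hQ0 : Q ≠ 0)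
    (hQ1 : Q ≠ 1) (hn : 0 < n) {X : Mn n} (hX : X.PosSemidef) :
    tau T (1 - Q) Q X = (Ring.inverse (1 - sandwich Q * T) X).trace := by
  set L := sandwich Q * T with hL
  set G := Ring.inverse (1 - L) with hG
  have hGL : G * (1 - L) = 1 :=
    Ring.inverse_mul_cancel _ (isUnit_one_sub_killed hTpos hTtr hirr hQ hQ2 hQ0 hQ1 hn)
  have hpos : ∀ r, (((L ^ r) X)).PosSemidef := fun r =>
    isPosMap_pow (isPosMap_killed hTpos hQ) r X hX
  set s : ℕ → ℝ := fun r => reTrace n ((L ^ r) X) with hs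
  have hanti : Antitone s := antitone_reTrace_killed_pow hTpos hTtr hQ hQ2 hX
  have hs0 : Filter.Tendsto s Filter.atTop (nhds 0) :=
    tendsto_reTrace_killed_pow hTpos hTtr hirr hQ hQ2 hQ0 hQ1 hn hX
  have hstr : ∀ r, ((L ^ r) X).trace = (s r : ℂ) := fun r => trace_eq_reTrace (hpos r)
  have hsum : ∀ N, ((∑ k ∈ Finset.range N, s k : ℝ) : ℂ) =
      (G X).trace - (traceLinearMap (Fin n) ℂ ℂ ∘ₗ G) ((L ^ N) X) := by
    intro N
    have hgeo : ∑ k ∈ Finset.range N, L ^ k = G - G * L ^ N := by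
      rw [← mul_one_sub, ← mul_neg_geom_sum, ← mul_assoc, hGL, one_mul]
    have := congrArg (fun F : Module.End ℂ (Mn n) => (F X).trace) hgeo
    simp only [LinearMap.sum_apply, trace_sum, hstr, LinearMap.sub_apply, trace_sub] at this
    rw [Complex.ofReal_sum, this]
    rfl
  have hlimC : Filter.Tendsto (fun N => ((∑ k ∈ Finset.range N, s k : ℝ) : ℂ)) Filter.atTop
      (nhds (G X).trace) := by
    simp only [hsum]
    simpa using tendsto_const_nhds.sub (tendsto_apply_killed_pow hTpos hTtr hirr hQ hQ2 hQ0 hQ1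
      hn hX (traceLinearMap (Fin n) ℂ ℂ ∘ₗ G))
  have hlimR : Filter.Tendsto (fun N => ∑ k ∈ Finset.range N, s k) Filter.atTop
      (nhds (G X).trace.re) :=
    (Complex.continuous_re.tendsto _).comp hlimC
  have hreal : (G X).trace = ((G X).trace.re : ℂ) :=
    tendsto_nhds_unique hlimC ((Complex.continuous_ofReal.tendsto _).comp hlimR)
  have hterm : ∀ r : ℕ, ((r : ℂ) + 1) * ((sandwich (1 - Q) * T * L ^ r : Module.End ℂ (Mn n)) X).trace =
      ((((r : ℝ) + 1) * (s r - s (r + 1)) : ℝ) : ℂ) := by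
    intro r
    rw [mul_assoc, Module.End.mul_apply, trace_one_sub_sandwich hQ2, ← Module.End.mul_apply,
      ← mul_assoc, ← hL, ← pow_succ', Module.End.mul_apply, hTtr, hstr, hstr]
    push_cast
    ring
  have habel : ∀ N : ℕ, ∑ r ∈ Finset.range N, ((r : ℝ) + 1) * (s r - s (r + 1)) =
      ∑ k ∈ Finset.range N, s k - (N : ℝ) * s N := by
    intro N
    induction N with
    | zero => simp
    | succ N ih =>
      rw [Finset.sum_range_succ, ih, Finset.sum_range_succ]
      push_cast
      ring
  have hhs : HasSum (fun r : ℕ => ((r : ℝ) + 1) * (s r - s (r + 1))) (G X).trace.re := by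
    rw [hasSum_iff_tendsto_nat_of_nonneg fun r =>
      mul_nonneg (by positivity) (sub_nonneg.mpr (hanti r.le_succ))]
    simp only [habel]
    simpa using hlimR.sub (tendsto_natCast_mul_of_antitone hanti hs0 hlimR)
  rw [show tau T (1 - Q) Q X = _ from tsum_congr hterm, hreal]
  exact (Complex.hasSum_ofReal.mpr hhs).tsum_eq

/-- With `K = T(1 - ℚT)⁻²` and `Z = (1 - T + Ω)⁻¹`, the compressed trace of `K(1 - ℚ)Z` on a
traceless matrix `D` only depends on the block `ℚ(D)`. -/
theorem trace_block_inverse (hTtr : IsTracePreserving T) (hQ2 : Q * Q = Q) {π : Mn n}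
    (hπtr : π.trace = 1)
    (hZ : IsUnit (1 - T + (traceLinearMap (Fin n) ℂ ℂ).smulRight π))
    (hL : IsUnit (1 - sandwich Q * T)) {D : Mn n} (hD : D.trace = 0) :
    (((1 - sandwich Q) * (T * Ring.inverse (1 - sandwich Q * T) ^ 2) * (1 - sandwich Q) :
        Module.End ℂ (Mn n)) ((1 - sandwich Q)
        (Ring.inverse (1 - T + (traceLinearMap (Fin n) ℂ ℂ).smulRight π) D))).trace =
      -(Ring.inverse (1 - sandwich Q * T) (sandwich Q D)).trace := by
  set G := Ring.inverse (1 - sandwich Q * T) with hG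
  set Y := Ring.inverse (1 - T + (traceLinearMap (Fin n) ℂ ℂ).smulRight π) D with hY
  have hYD : (1 - T + (traceLinearMap (Fin n) ℂ ℂ).smulRight π) Y = D := by
    rw [hY, ← Module.End.mul_apply, Ring.mul_inverse_cancel _ hZ, Module.End.one_apply]
  have hYtr : Y.trace = 0 := by
    have h := congrArg trace hYD
    simpa [hTtr Y, hπtr, hD] using h
  have hYT : Y - T Y = D := by simpa [hYtr] using hYD
  have hQQ : ∀ X, sandwich Q (sandwich Q X) = sandwich Q X := fun X => by
    rw [sandwich_apply, sandwich_apply,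
      show Q * (Q * X * Q) * Q = (Q * Q) * X * (Q * Q) by noncomm_ring, hQ2]
  have hcompl : (1 - sandwich Q) Y = (1 - sandwich Q * T) Y - sandwich Q D := by
    simp only [LinearMap.sub_apply, Module.End.one_apply, Module.End.mul_apply, ← hYT, map_sub]
    abel
  have hGX : ∀ X, G ((1 - sandwich Q * T) X) = X := fun X => by
    rw [← Module.End.mul_apply, hG, Ring.inverse_mul_cancel _ hL, Module.End.one_apply]
  have hXG : ∀ X, (1 - sandwich Q * T) (G X) = X := fun X => by
    rw [← Module.End.mul_apply, hG, Ring.mul_inverse_cancel _ hL, Module.End.one_apply]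
  have hcompl2 : (1 - sandwich Q) ((1 - sandwich Q) Y) = (1 - sandwich Q) Y := by
    simp [hQQ]
  have hout : ∀ W, ((1 - sandwich Q) (T W)).trace = ((1 - sandwich Q * T) W).trace := fun W => by
    simp [hTtr W]
  rw [Module.End.mul_apply, Module.End.mul_apply, hcompl2, Module.End.mul_apply, sq,
    Module.End.mul_apply, hout, hXG, hcompl, map_sub, hGX, trace_sub, hYtr, zero_sub]

end Hitting

end PosMapHitting

/-- MHTF for irreducible positive trace-preserving maps and orthogonal
states. With fixed map `Ω(X) = Tr(X)π`, fundamental map `Z = (I − T + Ω)^{−1}` and mean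
hitting time map `K = T(I − ℚT)^{−2}`, for unit vectors `ψ ∈ V` and `φ ∈ V^⊥`:
`τ(φ→V) = Tr(K₁₁(Z₁₁(ρ_ψ) − Z₁₂(ρ_φ)))`, and `Tr(K₁₁(Z₁₁(ρ_ψ)))` is independent of
the choice of `ψ ∈ V`. -/
theorem stmt16 {n : ℕ} (T : Module.End ℂ (Mn n))
    (hTpos : IsPosMap T) (hTtr : IsTracePreserving T) (hirr : IsIrreducibleMap T)
    (π : Mn n) (hπpsd : π.PosSemidef) (hπtr : π.trace = 1) (hπfix : T π = π)
    (hπuniq : ∀ σ : Mn n, σ.PosSemidef → σ.trace = 1 → T σ = σ → σ = π)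
    (P : Mn n) (hPH : P.IsHermitian) (hPidem : P * P = P)
    (hP0 : P ≠ 0) (hP1 : P ≠ 1)
    (Q : Mn n) (hQ : Q = 1 - P)
    (Ω : Module.End ℂ (Mn n)) (hΩ : Ω = (Matrix.traceLinearMap (Fin n) ℂ ℂ).smulRight π)
    (Z K : Module.End ℂ (Mn n))
    (hZ : Z = Ring.inverse (1 - T + Ω))
    (hK : K = T * (Ring.inverse (1 - sandwich Q * T)) ^ 2) :
    IsUnit (1 - T + Ω) ∧
    IsUnit (1 - sandwich Q * T) ∧
    (∀ ψ φ : Fin n → ℂ, star ψ ⬝ᵥ ψ = 1 → P.mulVec ψ = ψ →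
        star φ ⬝ᵥ φ = 1 → P.mulVec φ = 0 →
      tau T P Q (rhoOf φ) =
        (((1 - sandwich Q) * K * (1 - sandwich Q))
          ((((1 - sandwich Q) * Z * (1 - sandwich Q)) (rhoOf ψ))
            - (((1 - sandwich Q) * Z * sandwich Q) (rhoOf φ)))).trace) ∧
    (∀ ψ ψ' : Fin n → ℂ, star ψ ⬝ᵥ ψ = 1 → P.mulVec ψ = ψ →
        star ψ' ⬝ᵥ ψ' = 1 → P.mulVec ψ' = ψ' →
      ((((1 - sandwich Q) * K * (1 - sandwich Q)) ∘ₗ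
          ((1 - sandwich Q) * Z * (1 - sandwich Q))) (rhoOf ψ)).trace =
      ((((1 - sandwich Q) * K * (1 - sandwich Q)) ∘ₗ
          ((1 - sandwich Q) * Z * (1 - sandwich Q))) (rhoOf ψ')).trace) := by
  have hn : 0 < n := by
    rcases Nat.eq_zero_or_pos n with rfl | h
    · exact absurd (Subsingleton.elim P 0) hP0
    · exact h
  have hQH : Q.IsHermitian := hQ ▸ Matrix.isHermitian_one.sub hPH
  have hQ2 : Q * Q = Q := by
    rw [hQ]
    simp [mul_sub, sub_mul, hPidem]
  have hPQ : P = 1 - Q := by rw [hQ, sub_sub_cancel]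
  have hQ0 : Q ≠ 0 := fun h => hP1 (by rw [hPQ, h, sub_zero])
  have hQ1 : Q ≠ 1 := fun h => hP0 (by rw [hPQ, h, sub_self])
  have hZu : IsUnit (1 - T + Ω) :=
    hΩ ▸ PosMapHitting.isUnit_one_sub_add hTpos hTtr hirr hn hπtr hπfix
  have hLu : IsUnit (1 - sandwich Q * T) :=
    PosMapHitting.isUnit_one_sub_killed hTpos hTtr hirr hQH hQ2 hQ0 hQ1 hn
  have hsw : ∀ x, sandwich Q (rhoOf x) = rhoOf (Q *ᵥ x) := fun x => by
    rw [PosMapHitting.sandwich_apply, ← PosMapHitting.mul_rhoOf_mul, hQH.eq]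
  have hV : ∀ x, P *ᵥ x = x → sandwich Q (rhoOf x) = 0 := fun x hx => by
    rw [hsw, hQ, sub_mulVec, one_mulVec, hx, sub_self, PosMapHitting.rhoOf_zero]
  have hVperp : ∀ x, P *ᵥ x = 0 → sandwich Q (rhoOf x) = rhoOf x := fun x hx => by
    rw [hsw, hQ, sub_mulVec, one_mulVec, hx, sub_zero]
  have htr : ∀ x : Fin n → ℂ, star x ⬝ᵥ x = 1 → (rhoOf x).trace = 1 := fun x hx => by
    rw [rhoOf, trace_vecMulVec, dotProduct_comm, hx]
  have hblock : ∀ D : Mn n, D.trace = 0 →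
      (((1 - sandwich Q) * K * (1 - sandwich Q)) ((1 - sandwich Q) (Z D))).trace =
        -(Ring.inverse (1 - sandwich Q * T) (sandwich Q D)).trace := fun D hD => by
    subst hΩ hZ hK
    exact PosMapHitting.trace_block_inverse hTtr hQ2 hπtr hZu hLu hD
  refine ⟨hZu, hLu, fun ψ φ hψ hψV hφ hφV => ?_, fun ψ ψ' hψ hψV hψ' hψV' => ?_⟩
  · have h := hblock (rhoOf ψ - rhoOf φ) (by rw [trace_sub, htr ψ hψ, htr φ hφ, sub_self])
    rw [map_sub (sandwich Q), hV ψ hψV, hVperp φ hφV, zero_sub, map_neg, trace_neg, neg_neg] at h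
    rw [hPQ, PosMapHitting.tau_eq_trace_inverse hTpos hTtr hirr hQH hQ2 hQ0 hQ1 hn
      (PosMapHitting.posSemidef_rhoOf φ), ← h]
    simp only [Module.End.mul_apply (_ * Z)]
    rw [LinearMap.sub_apply 1 (sandwich Q) (rhoOf ψ), hV ψ hψV, hVperp φ hφV, sub_zero,
      Module.End.one_apply, Module.End.mul_apply _ Z, Module.End.mul_apply _ Z, map_sub Z,
      map_sub (1 - sandwich Q)]
  · have h := hblock (rhoOf ψ - rhoOf ψ') (by rw [trace_sub, htr ψ hψ, htr ψ' hψ', sub_self])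
    rw [map_sub (sandwich Q), hV ψ hψV, hV ψ' hψV', sub_zero, map_zero, trace_zero, neg_zero,
      map_sub Z, map_sub, map_sub, trace_sub, sub_eq_zero] at h
    have hcomp : ∀ x, P *ᵥ x = x →
        ((1 - sandwich Q) * Z * (1 - sandwich Q)) (rhoOf x) = (1 - sandwich Q) (Z (rhoOf x)) :=
      fun x hx => by
        rw [Module.End.mul_apply, LinearMap.sub_apply 1 (sandwich Q) (rhoOf x), hV x hx, sub_zero,
          Module.End.one_apply, Module.End.mul_apply]
    rw [LinearMap.comp_apply, LinearMap.comp_apply, hcomp ψ hψV, hcomp ψ' hψV', h]
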